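/- arXiv:1605.02048 — 2 statements merged into one kernel-verified Lean document; each statement's English description precedes it below -/
import Mathlib

section
/- Let u = Σ a_n T^n be a convergent power series with a_0 ≠ 0 (a unit). Then the map w ↦ u • w is a bijection from the space of continuous functions ℝ → ℝ onto itself. -/
/-- The normalized indefinite integral: `(V w) x = ∫_0^x w(t) dt`. -/
noncomputable def V (w : ℝ → ℝ) : ℝ → ℝ := fun x => ∫ t in (0:ℝ)..x, w t

/-- Coefficient sequences for which `∑ a n * (V^[n] w) x` converges absolutely for all continuous
`w`, by the bound `abs_iterate_V_le`. -/
def BorelSummable (a : ℕ → ℝ) : Prop :=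
  ∀ R : ℝ, 0 ≤ R → Summable fun n => |a n| * (R ^ n / n.factorial)

/-- The action of the series with coefficients `a` on functions. -/
noncomputable def seriesAct (a : ℕ → ℝ) (w : ℝ → ℝ) : ℝ → ℝ := fun x => ∑' n, a n * (V^[n] w) x

theorem BorelSummable.of_le_geometric {a : ℕ → ℝ} {C K : ℝ}
    (h : ∀ n, |a n| ≤ C * K ^ n) : BorelSummable a := by
  intro R hR
  refine Summable.of_nonneg_of_le (fun n => by positivity) (fun n => ?_)
    ((Real.summable_pow_div_factorial (K * R)).mul_left C)
  calc |a n| * (R ^ n / n.factorial) ≤ C * K ^ n * (R ^ n / n.factorial) := by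
        gcongr; exact h n
    _ = C * ((K * R) ^ n / n.factorial) := by rw [mul_pow]; ring

theorem continuous_V {w : ℝ → ℝ} (hw : Continuous w) : Continuous (V w) :=
  intervalIntegral.continuous_primitive (fun _ _ => hw.intervalIntegrable _ _) 0

theorem continuous_iterate_V {w : ℝ → ℝ} (hw : Continuous w) (n : ℕ) : Continuous (V^[n] w) := by
  induction n with
  | zero => exact hw
  | succ n ih => rw [Function.iterate_succ_apply']; exact continuous_V ih

theorem abs_iterate_V_le {w : ℝ → ℝ} (hw : Continuous w) {R M : ℝ}
    (hM : ∀ x, |x| ≤ R → |w x| ≤ M) (n : ℕ) :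
    ∀ x, |x| ≤ R → |(V^[n] w) x| ≤ M * (|x| ^ n / n.factorial) := by
  induction n with
  | zero => simpa using hM
  | succ n ih =>
    intro x hx
    rw [Function.iterate_succ_apply']
    have hc : Continuous fun t : ℝ => M * (|t| ^ n / n.factorial) := by fun_prop
    have hcw := continuous_iterate_V hw n
    have hpow (y : ℝ) (hy : 0 ≤ y) : ∫ t in (0 : ℝ)..y, M * (|t| ^ n / n.factorial) =
        M * (y ^ (n + 1) / (n + 1).factorial) := by
      have : ∫ t in (0 : ℝ)..y, M * (|t| ^ n / n.factorial) =
          ∫ t in (0 : ℝ)..y, M * (t ^ n / n.factorial) := by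
        refine intervalIntegral.integral_congr fun t ht => ?_
        rw [Set.uIcc_of_le hy] at ht
        simp only [abs_of_nonneg ht.1]
      rw [this, intervalIntegral.integral_const_mul, intervalIntegral.integral_div, integral_pow,
        Nat.factorial_succ]
      push_cast
      have : (n.factorial : ℝ) ≠ 0 := by positivity
      field_simp
      simp
    have key (g : ℝ → ℝ) (hg : ∀ t, |t| ≤ R → |g t| ≤ M * (|t| ^ n / n.factorial))
        (y : ℝ) (hy : 0 ≤ y) (hyR : y ≤ R) :
        |∫ t in (0 : ℝ)..y, g t| ≤ M * (y ^ (n + 1) / (n + 1).factorial) := by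
      rw [← hpow y hy, ← Real.norm_eq_abs]
      refine intervalIntegral.norm_integral_le_of_norm_le hy
        (.of_forall fun t ht => hg t ?_) (hc.intervalIntegrable _ _)
      rw [abs_of_pos ht.1]
      exact ht.2.trans hyR
    rcases le_total 0 x with h | h
    · rw [abs_of_nonneg h] at hx ⊢
      exact key _ ih x h hx
    · rw [abs_of_nonpos h] at hx ⊢
      have := key (fun t => (V^[n] w) (-t)) (fun t ht => by
        simpa using ih (-t) (by simpa using ht)) (-x) (by linarith) hx
      rw [intervalIntegral.integral_comp_neg, neg_neg, neg_zero,
        intervalIntegral.integral_symm, abs_neg] at this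
      exact this

theorem exists_abs_iterate_V_le {w : ℝ → ℝ} (hw : Continuous w) {R : ℝ} :
    ∃ M, 0 ≤ M ∧ ∀ n x, |x| ≤ R → |(V^[n] w) x| ≤ M * (R ^ n / n.factorial) := by
  obtain ⟨M, hM⟩ := (isCompact_Icc (a := -R) (b := R)).exists_bound_of_continuousOn hw.continuousOn
  have hM' : ∀ x, |x| ≤ R → |w x| ≤ max M 0 := fun x hx =>
    (hM x (abs_le.mp hx)).trans (le_max_left _ _)
  refine ⟨max M 0, le_max_right _ _, fun n x hx => (abs_iterate_V_le hw hM' n x hx).trans ?_⟩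
  gcongr

theorem continuous_seriesAct {a : ℕ → ℝ} (ha : BorelSummable a) {w : ℝ → ℝ} (hw : Continuous w) :
    Continuous (seriesAct a w) := by
  rw [continuous_iff_continuousAt]
  intro x
  obtain ⟨M, hM0, hM⟩ := exists_abs_iterate_V_le hw (R := |x| + 1)
  have hcont : ContinuousOn (seriesAct a w) (Metric.ball 0 (|x| + 1)) := by
    refine continuousOn_tsum
      (fun n => (continuous_const.mul (continuous_iterate_V hw n)).continuousOn)
      ((ha (|x| + 1) (by positivity)).mul_left M) fun n y hy => ?_
    rw [Real.norm_eq_abs, abs_mul, mul_left_comm]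
    gcongr
    exact hM n y (by simpa using (mem_ball_zero_iff.mp hy).le)
  exact hcont.continuousAt (Metric.isOpen_ball.mem_nhds (by simp))

theorem V_seriesAct {a : ℕ → ℝ} (ha : BorelSummable a) {w : ℝ → ℝ} (hw : Continuous w) :
    V (seriesAct a w) = seriesAct a (V w) := by
  ext x
  obtain ⟨M, hM0, hM⟩ := exists_abs_iterate_V_le hw (R := |x|)
  let f (n : ℕ) : C(ℝ, ℝ) := ⟨fun t => a n * (V^[n] w) t,
    continuous_const.mul (continuous_iterate_V hw n)⟩
  have hf : Summable fun n =>
      ‖(f n).restrict (⟨Set.uIcc 0 x, isCompact_uIcc⟩ : TopologicalSpace.Compacts ℝ)‖ := by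
    refine Summable.of_nonneg_of_le (fun _ => norm_nonneg _) (fun n => ?_)
      ((ha |x| (abs_nonneg x)).mul_left M)
    refine (ContinuousMap.norm_le _ (by positivity)).2 fun ⟨t, ht⟩ => ?_
    have htx : |t| ≤ |x| := by simpa using Set.abs_sub_left_of_mem_uIcc ht
    change |a n * (V^[n] w) t| ≤ _
    rw [abs_mul, mul_left_comm]
    gcongr
    exact hM n t htx
  have := (intervalIntegral.hasSum_intervalIntegral_of_summable_norm hf).tsum_eq
  change ∫ t in (0 : ℝ)..x, ∑' n, f n t = _
  rw [← this]
  refine tsum_congr fun n => ?_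
  change ∫ t in (0 : ℝ)..x, a n * (V^[n] w) t = _
  rw [intervalIntegral.integral_const_mul, ← Function.iterate_succ_apply,
    Function.iterate_succ_apply']
  rfl

theorem iterate_V_seriesAct {a : ℕ → ℝ} (ha : BorelSummable a) {w : ℝ → ℝ} (hw : Continuous w)
    (m : ℕ) : V^[m] (seriesAct a w) = seriesAct a (V^[m] w) := by
  induction m with
  | zero => rfl
  | succ m ih =>
    rw [Function.iterate_succ_apply', ih, V_seriesAct ha (continuous_iterate_V hw m),
      Function.iterate_succ_apply']

theorem seriesAct_seriesAct {a b : ℕ → ℝ} (ha : BorelSummable a) (hb : BorelSummable b)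
    {w : ℝ → ℝ} (hw : Continuous w) :
    seriesAct b (seriesAct a w) =
      seriesAct (fun n => ∑ p ∈ Finset.HasAntidiagonal.antidiagonal n, b p.1 * a p.2) w := by
  ext x
  obtain ⟨M, hM0, hM⟩ := exists_abs_iterate_V_le hw (R := |x|)
  let F (p : ℕ × ℕ) : ℝ := b p.1 * a p.2 * (V^[p.1 + p.2] w) x
  have hF : Summable F := by
    refine Summable.of_norm_bounded
      (((hb |x| (abs_nonneg x)).mul_of_nonneg (ha |x| (abs_nonneg x))
        (fun _ => by positivity) (fun _ => by positivity)).mul_left M) fun ⟨m, n⟩ => ?_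
    have hfac : (m.factorial * n.factorial : ℝ) ≤ (m + n).factorial := by
      exact_mod_cast Nat.le_of_dvd (Nat.factorial_pos _) (Nat.factorial_mul_factorial_dvd_factorial_add m n)
    calc ‖F (m, n)‖ = |b m| * |a n| * |(V^[m + n] w) x| := by simp [F]
      _ ≤ |b m| * |a n| * (M * (|x| ^ (m + n) / (m + n).factorial)) := by
        gcongr; exact hM _ x le_rfl
      _ ≤ |b m| * |a n| * (M * (|x| ^ (m + n) / (m.factorial * n.factorial))) := by
        gcongr
      _ = _ := by rw [pow_add]; field_simp
  have h₁ : seriesAct b (seriesAct a w) x = ∑' p, F p := by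
    rw [hF.tsum_prod]
    refine tsum_congr fun m => ?_
    rw [iterate_V_seriesAct ha hw, seriesAct, ← tsum_mul_left]
    refine tsum_congr fun n => ?_
    simp only [F]
    rw [← Function.iterate_add_apply, add_comm n m, mul_assoc]
  rw [h₁, ← Finset.HasAntidiagonal.sigmaAntidiagonalEquivProd.tsum_eq F]
  refine (Finset.HasAntidiagonal.sigmaAntidiagonalEquivProd.summable_iff.mpr hF).tsum_sigma.trans ?_
  refine tsum_congr fun n => ?_
  rw [tsum_fintype, Finset.sum_mul,
    ← Finset.sum_coe_sort (Finset.HasAntidiagonal.antidiagonal n)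
      fun p => b p.1 * a p.2 * (V^[n] w) x]
  refine Finset.sum_congr rfl fun p _ => ?_
  simp [F, Finset.HasAntidiagonal.mem_antidiagonal.mp p.2]

theorem seriesAct_one (w : ℝ → ℝ) : seriesAct (fun n => if n = 0 then 1 else 0) w = w := by
  ext x
  rw [seriesAct, tsum_eq_single 0 (fun n hn => by simp [hn])]
  simp

theorem BorelSummable.of_convergent {a : ℕ → ℝ} {r : ℝ} (hr : 0 < r)
    (h : Summable fun n => |a n| * r ^ n) : BorelSummable a := by
  refine .of_le_geometric (C := ∑' n, |a n| * r ^ n) (K := r⁻¹) fun n => ?_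
  rw [inv_pow, ← div_eq_mul_inv, le_div_iff₀ (by positivity)]
  exact h.le_tsum n fun _ _ => by positivity

/-- The inverse of a convergent power series with nonzero constant term has at most geometric
coefficient growth. -/
theorem borelSummable_inv {a : ℕ → ℝ} {r : ℝ} (hr : 0 < r)
    (h : Summable fun n => |a n| * r ^ n) (ha : a 0 ≠ 0) :
    BorelSummable fun n => PowerSeries.coeff n (PowerSeries.mk a)⁻¹ := by
  set S := ∑' n, |a n| * r ^ n
  have ha' : 0 < |a 0| := abs_pos.2 ha
  have hS : 0 ≤ S := tsum_nonneg fun _ => by positivity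
  obtain ⟨t, ht, ht1, htS⟩ : ∃ t : ℝ, 0 < t ∧ t ≤ 1 ∧ t * S ≤ |a 0| := by
    refine ⟨|a 0| / (S + |a 0|), by positivity, ?_, ?_⟩
    · rw [div_le_one (by positivity)]; linarith
    · rw [div_mul_eq_mul_div, div_le_iff₀ (by positivity)]; nlinarith
  refine .of_le_geometric (C := |a 0|⁻¹) (K := (t * r)⁻¹) fun n => ?_
  induction n using Nat.strong_induction_on with
  | _ n ih =>
    rcases Nat.eq_zero_or_pos n with rfl | hn
    · simp [abs_inv]
    rw [PowerSeries.coeff_inv, if_neg hn.ne', abs_mul, abs_neg]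
    simp only [PowerSeries.constantCoeff_mk, PowerSeries.coeff_mk, abs_inv]
    gcongr
    have hsum : ∑ p ∈ Finset.HasAntidiagonal.antidiagonal n, |a p.1| * r ^ p.1 ≤ S := by
      rw [Finset.Nat.sum_antidiagonal_eq_sum_range_succ_mk]
      exact h.sum_le_tsum _ fun _ _ => by positivity
    calc |∑ p ∈ Finset.HasAntidiagonal.antidiagonal n, if p.2 < n then
            a p.1 * PowerSeries.coeff p.2 (PowerSeries.mk a)⁻¹ else 0|
        ≤ ∑ p ∈ Finset.HasAntidiagonal.antidiagonal n, (|a p.1| * r ^ p.1) * (t * |a 0|⁻¹ * (t * r)⁻¹ ^ n) := by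
          refine (Finset.abs_sum_le_sum_abs _ _).trans (Finset.sum_le_sum fun ⟨i, j⟩ hij => ?_)
          have hij : i + j = n := Finset.HasAntidiagonal.mem_antidiagonal.mp hij
          dsimp only
          split_ifs with hj
          · have hi : i ≠ 0 := by omega
            have hti : t ^ i ≤ t := pow_le_of_le_one ht.le ht1 hi
            rw [abs_mul]
            calc |a i| * |PowerSeries.coeff j (PowerSeries.mk a)⁻¹|
                ≤ |a i| * (|a 0|⁻¹ * (t * r)⁻¹ ^ j) := by gcongr; exact ih j hj
              _ = (|a i| * r ^ i) * (t ^ i * |a 0|⁻¹ * (t * r)⁻¹ ^ n) := by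
                rw [← hij, pow_add]; simp only [inv_pow, mul_pow]; field_simp
              _ ≤ _ := by gcongr
          · rw [abs_zero]; positivity
      _ = (∑ p ∈ Finset.HasAntidiagonal.antidiagonal n, |a p.1| * r ^ p.1) * (t * |a 0|⁻¹ * (t * r)⁻¹ ^ n) := by
          rw [Finset.sum_mul]
      _ ≤ S * (t * |a 0|⁻¹ * (t * r)⁻¹ ^ n) := by gcongr
      _ = (t * S) * |a 0|⁻¹ * (t * r)⁻¹ ^ n := by ring
      _ ≤ |a 0| * |a 0|⁻¹ * (t * r)⁻¹ ^ n := by gcongr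
      _ = (t * r)⁻¹ ^ n := by rw [mul_inv_cancel₀ ha'.ne', one_mul]

/-- If `u = Σ a_n T^n` is a convergent power series with `a 0 ≠ 0` (a unit), then
`w ↦ u • w` is a bijection from the space of continuous functions `ℝ → ℝ` onto itself. -/
theorem unit_action_bijective (a : ℕ → ℝ)
    (hconv : ∃ r : ℝ, 0 < r ∧ Summable (fun n => |a n| * r ^ n)) (ha : a 0 ≠ 0) :
    Set.BijOn (fun w : ℝ → ℝ => fun x => ∑' n, a n * (V^[n] w) x)
      {w : ℝ → ℝ | Continuous w} {w : ℝ → ℝ | Continuous w} := by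
  obtain ⟨r, hr, h⟩ := hconv
  have hA := BorelSummable.of_convergent hr h
  have hB := borelSummable_inv hr h ha
  have hunit : PowerSeries.constantCoeff (PowerSeries.mk a) ≠ 0 := by simpa using ha
  refine Set.InvOn.bijOn (f' := seriesAct fun n => PowerSeries.coeff n (PowerSeries.mk a)⁻¹)
    ⟨fun w hw => ?_, fun w hw => ?_⟩
    (fun w hw => continuous_seriesAct hA hw) (fun w hw => continuous_seriesAct hB hw)
  · refine (seriesAct_seriesAct hA hB hw).trans (Eq.trans ?_ (seriesAct_one w))
    congr 1
    ext n
    rw [← PowerSeries.coeff_one, ← PowerSeries.inv_mul_cancel _ hunit, PowerSeries.coeff_mul]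
    simp
  · refine (seriesAct_seriesAct hB hA hw).trans (Eq.trans ?_ (seriesAct_one w))
    congr 1
    ext n
    rw [← PowerSeries.coeff_one, ← PowerSeries.mul_inv_cancel _ hunit, PowerSeries.coeff_mul]
    simp
end

section
/- Fix a natural number n, and let h : ℝ → ℝ be the function h(t) = √(1+t²) (1 + √(1+t²))^n, which is analytic at 0; let a_k = (iterated derivative of order k of h at 0)/k! denote its Taylor coefficients at 0. Then for every real number x, Σ_{k≥0} a_k (V^k J_n)(x) = x^n / n!, where J_n is the Bessel function of the first kind of order n. (This expresses that J_n solves the differential equation j_n(D)w = 0 associated with the rational function y(x+y)^n on the hyperbola y² − x² = 1.) -/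
/-- The Bessel function of the first kind of (natural) order `n`. -/
noncomputable def besselJ (n : ℕ) : ℝ → ℝ := fun x =>
  ∑' k : ℕ, (-1) ^ k / ((Nat.factorial k : ℝ) * (Nat.factorial (k + n))) * (x / 2) ^ (2 * k + n)

/-- The Taylor series at `0` of a function `ℝ → ℝ`, as a formal power series. -/
noncomputable def taylorSeries (f : ℝ → ℝ) : PowerSeries ℝ :=
  PowerSeries.mk fun k => iteratedDeriv k f 0 / (Nat.factorial k)

lemma taylorSeries_mul {f g : ℝ → ℝ} (hf : AnalyticAt ℝ f 0) (hg : AnalyticAt ℝ g 0) :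
    taylorSeries (f * g) = taylorSeries f * taylorSeries g := by
  ext k
  rw [PowerSeries.coeff_mul, Finset.Nat.sum_antidiagonal_eq_sum_range_succ_mk]
  simp only [taylorSeries, PowerSeries.coeff_mk]
  rw [iteratedDeriv_mul hf.contDiffAt hg.contDiffAt, Finset.sum_div]
  refine Finset.sum_congr rfl fun i hi => ?_
  have hik : i ≤ k := Nat.lt_succ_iff.1 (Finset.mem_range.1 hi)
  rw [Nat.cast_choose ℝ hik]
  field_simp

lemma taylorSeries_add {f g : ℝ → ℝ} (hf : AnalyticAt ℝ f 0) (hg : AnalyticAt ℝ g 0) :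
    taylorSeries (f + g) = taylorSeries f + taylorSeries g := by
  ext k
  simp only [taylorSeries, PowerSeries.coeff_mk, map_add]
  rw [iteratedDeriv_add hf.contDiffAt hg.contDiffAt, add_div]

lemma taylorSeries_one : taylorSeries 1 = 1 := by
  ext k
  rcases k with _ | k
  · simp [taylorSeries]
  · have : iteratedDeriv (k + 1) (1 : ℝ → ℝ) 0 = 0 := by
      exact (iteratedDeriv_const (𝕜 := ℝ) (n := k + 1) (c := (1 : ℝ))).trans (by simp)
    simp [taylorSeries, PowerSeries.coeff_one, this]

lemma taylorSeries_id : taylorSeries id = PowerSeries.X := by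
  ext k
  simp only [taylorSeries, PowerSeries.coeff_mk, PowerSeries.coeff_X]
  rcases k with _ | _ | k
  · simp
  · simp
  · simp [iteratedDeriv_succ', iteratedDeriv_const]

lemma taylorSeries_pow {f : ℝ → ℝ} (hf : AnalyticAt ℝ f 0) (n : ℕ) :
    taylorSeries (f ^ n) = taylorSeries f ^ n := by
  induction n with
  | zero => simpa using taylorSeries_one
  | succ n ih => rw [pow_succ, pow_succ, taylorSeries_mul (hf.pow n) hf, ih]

/-- Taylor coefficients of an analytic function grow at most geometrically. -/
lemma exists_taylorSeries_coeff_le {f : ℝ → ℝ} (hf : AnalyticAt ℝ f 0) :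
    ∃ C R : ℝ, 0 ≤ C ∧ 0 ≤ R ∧ ∀ k, |(taylorSeries f).coeff k| ≤ C * R ^ k := by
  obtain ⟨C, r, hC, hr, h⟩ :=
    FormalMultilinearSeries.le_mul_pow_of_radius_pos _ hf.hasFPowerSeriesAt.radius_pos
  refine ⟨C, r, hC.le, hr.le, fun k => ?_⟩
  simpa [taylorSeries, FormalMultilinearSeries.ofScalars_norm, abs_div] using h k

/-- The coefficients of `1 / (√(1+t²) (1+√(1+t²))^n)`. -/
noncomputable def besselCoeff (n k : ℕ) : ℝ :=
  if Even k then (-1 / 4) ^ (k / 2) * ((k + n).choose (k / 2)) / 2 ^ n else 0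

lemma abs_besselCoeff_le_one (n k : ℕ) : |besselCoeff n k| ≤ 1 := by
  unfold besselCoeff
  split_ifs with hk
  · obtain ⟨m, rfl⟩ := hk
    have h2 : (m + m) / 2 = m := by omega
    rw [h2, abs_div, abs_mul, abs_pow, div_le_one (by positivity)]
    have h1 : (((m + m + n).choose m : ℕ) : ℝ) ≤ 2 ^ (m + m + n) := by
      exact_mod_cast Nat.choose_le_two_pow _ _
    have h3 : |(-1 / 4 : ℝ)| = 1 / 4 := by norm_num [abs_div]
    rw [h3, abs_of_nonneg (by positivity : (0 : ℝ) ≤ ((m + m + n).choose m : ℕ)),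
      abs_of_pos (by positivity : (0 : ℝ) < 2 ^ n)]
    calc (1 / 4 : ℝ) ^ m * ((m + m + n).choose m : ℕ) ≤ (1 / 4) ^ m * 2 ^ (m + m + n) := by gcongr
      _ = 2 ^ n := by
        rw [← two_mul, pow_add, pow_mul, ← mul_assoc, ← mul_pow]; norm_num
  · simp

/-- The generating function of `besselCoeff n`. -/
noncomputable def besselSeries (n : ℕ) : PowerSeries ℝ := PowerSeries.mk (besselCoeff n)

lemma besselSeries_zero : besselSeries 0 = 1 - PowerSeries.X ^ 2 * besselSeries 1 := by
  ext k
  rcases k with _ | _ | k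
  · simp [besselSeries, besselCoeff]
  · simp [besselSeries, besselCoeff, PowerSeries.coeff_X_pow_mul', PowerSeries.coeff_one]
  · rw [map_sub, add_assoc, PowerSeries.coeff_X_pow_mul]
    simp only [besselSeries, PowerSeries.coeff_mk, PowerSeries.coeff_one, besselCoeff]
    by_cases hk : Even k
    · have hk' : Even (k + (1 + 1)) := by rw [Nat.even_add]; simp [hk]
      rw [if_pos hk, if_pos hk', if_neg (by omega)]
      obtain ⟨m, rfl⟩ := hk
      rw [show (m + m + (1 + 1)) / 2 = m + 1 by omega, show (m + m) / 2 = m by omega]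
      have : (m + m + (1 + 1) + 0).choose (m + 1) = 2 * (m + m + 1).choose m := by
        rw [show m + m + (1 + 1) + 0 = (m + m + 1) + 1 by ring, Nat.choose_succ_succ,
          Nat.choose_symm_of_eq_add (show m + m + 1 = (m + 1) + m by ring)]
        ring
      rw [this]
      push_cast
      ring
    · have hk' : ¬ Even (k + (1 + 1)) := by rw [Nat.even_add]; simp [hk]
      rw [if_neg hk, if_neg hk', if_neg (by omega)]
      simp

lemma two_mul_besselSeries_succ (n : ℕ) :
    2 * besselSeries (n + 1) = besselSeries n - PowerSeries.X ^ 2 * besselSeries (n + 2) := by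
  ext k
  rw [two_mul, map_add, map_sub]
  rcases k with _ | _ | k
  · simp [besselSeries, besselCoeff]
    field_simp
    ring
  · simp [besselSeries, besselCoeff, PowerSeries.coeff_X_pow_mul']
  · rw [add_assoc, PowerSeries.coeff_X_pow_mul]
    simp only [besselSeries, PowerSeries.coeff_mk, besselCoeff]
    by_cases hk : Even k
    · have hk' : Even (k + (1 + 1)) := by rw [Nat.even_add]; simp [hk]
      rw [if_pos hk, if_pos hk', if_pos hk']
      obtain ⟨m, rfl⟩ := hk
      rw [show (m + m + (1 + 1)) / 2 = m + 1 by omega, show (m + m) / 2 = m by omega,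
        show m + m + (1 + 1) + (n + 1) = (m + m + (n + 2)) + 1 by ring, Nat.choose_succ_succ,
        show m + m + (1 + 1) + n = m + m + (n + 2) by ring]
      push_cast
      field_simp
      ring
    · have hk' : ¬ Even (k + (1 + 1)) := by rw [Nat.even_add]; simp [hk]
      rw [if_neg hk, if_neg hk', if_neg hk']
      simp

lemma eq_zero_of_bessel_recurrence {D : ℕ → PowerSeries ℝ}
    (h0 : D 0 = -(PowerSeries.X ^ 2 * D 1))
    (h1 : ∀ n, 2 * D (n + 1) = D n - PowerSeries.X ^ 2 * D (n + 2)) (n : ℕ) : D n = 0 := by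
  have key : ∀ m n, (PowerSeries.X : PowerSeries ℝ) ^ m ∣ D n := by
    intro m
    induction m with
    | zero => simp
    | succ m ih =>
      have hX : ∀ n, (PowerSeries.X : PowerSeries ℝ) ^ (m + 1) ∣ PowerSeries.X ^ 2 * D n := by
        intro n
        rw [pow_succ', pow_two, mul_assoc]
        exact mul_dvd_mul_left _ ((ih n).mul_left _)
      intro n
      induction n with
      | zero => rw [h0]; exact (hX 1).neg_right
      | succ n ihn =>
        have h2 := h1 n ▸ dvd_sub ihn (hX (n + 2))
        have hD : D (n + 1) = PowerSeries.C (1 / 2 : ℝ) * (2 * D (n + 1)) := by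
          rw [← mul_assoc, ← map_ofNat (PowerSeries.C (R := ℝ)) 2, ← map_mul]
          norm_num
        rw [hD]
        exact h2.mul_left _
  ext k
  simpa using PowerSeries.X_pow_dvd_iff.1 (key (k + 1) n) k (Nat.lt_succ_self k)

/-- `besselSeries n` inverts `S (1 + S)^n`, where `S = √(1 + X²)`. -/
lemma mul_besselSeries {S : PowerSeries ℝ} (hS : S ^ 2 = 1 + PowerSeries.X ^ 2)
    (hS0 : S.constantCoeff = 1) (n : ℕ) : S * (1 + S) ^ n * besselSeries n = 1 := by
  have e1 : S * S⁻¹ = 1 := PowerSeries.mul_inv_cancel _ (by simp [hS0])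
  have e2 : (1 + S) * (1 + S)⁻¹ = 1 := PowerSeries.mul_inv_cancel _ (by simp [hS0])
  generalize S⁻¹ = U at e1
  generalize (1 + S)⁻¹ = W at e2
  have hX : (PowerSeries.X : PowerSeries ℝ) ^ 2 = S ^ 2 - 1 := by rw [hS]; ring
  have hB : besselSeries n - U * W ^ n = 0 := by
    refine eq_zero_of_bessel_recurrence (D := fun n => besselSeries n - U * W ^ n) ?_ ?_ n
    · simp only [besselSeries_zero, hX]
      linear_combination -e1 - (S - 1) * U * e2
    · intro n
      have := two_mul_besselSeries_succ n
      rw [hX] at this ⊢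
      linear_combination this - (U * W ^ n) * ((S - 1) * W + 1) * e2
  rw [sub_eq_zero.1 hB]
  calc S * (1 + S) ^ n * (U * W ^ n) = (S * U) * ((1 + S) * W) ^ n := by rw [mul_pow]; ring
    _ = 1 := by rw [e1, e2]; simp

/-- `∑ c_j x^(j+q) / (j+q)!`. -/
noncomputable def borelSum (c : ℕ → ℝ) (q : ℕ) (x : ℝ) : ℝ :=
  ∑' j, c j * (x ^ (j + q) / (Nat.factorial (j + q)))

lemma pow_div_factorial_add_le {x : ℝ} (hx : 0 ≤ x) (j q : ℕ) :
    x ^ (j + q) / (Nat.factorial (j + q)) ≤ x ^ j / (Nat.factorial j) * x ^ q := by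
  rw [pow_add, div_mul_eq_mul_div]
  have : (Nat.factorial j : ℝ) ≤ Nat.factorial (j + q) := by
    exact_mod_cast Nat.factorial_le (Nat.le_add_right _ _)
  gcongr

lemma V_borelSum {c : ℕ → ℝ} (hc : ∀ j, |c j| ≤ 1) (q : ℕ) :
    V (borelSum c q) = borelSum c (q + 1) := by
  ext x
  let f : ℕ → C(ℝ, ℝ) := fun j =>
    ⟨fun t => c j * (t ^ (j + q) / (Nat.factorial (j + q))), by fun_prop⟩
  have hsum : Summable fun j =>
      ‖(f j).restrict (⟨Set.uIcc 0 x, isCompact_uIcc⟩ : TopologicalSpace.Compacts ℝ)‖ := by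
    refine Summable.of_nonneg_of_le (fun _ => norm_nonneg _) (fun j => ?_)
      ((Real.summable_pow_div_factorial |x|).mul_right (|x| ^ q))
    rw [ContinuousMap.norm_le _ (by positivity)]
    rintro ⟨t, ht⟩
    have htx : |t| ≤ |x| := by simpa using Set.abs_sub_left_of_mem_uIcc ht
    refine le_trans ?_ (pow_div_factorial_add_le (abs_nonneg x) j q)
    simp only [f, ContinuousMap.restrict_apply, ContinuousMap.coe_mk, Real.norm_eq_abs, abs_mul,
      abs_div, abs_pow, Nat.abs_cast]
    calc |c j| * (|t| ^ (j + q) / (Nat.factorial (j + q)))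
        ≤ 1 * (|x| ^ (j + q) / (Nat.factorial (j + q))) := by gcongr; exact hc j
      _ = _ := one_mul _
  have h := (intervalIntegral.hasSum_intervalIntegral_of_summable_norm hsum).tsum_eq
  refine h.symm.trans (tsum_congr fun j => ?_)
  simp only [f, ContinuousMap.coe_mk, intervalIntegral.integral_const_mul,
    intervalIntegral.integral_div, integral_pow]
  rw [← add_assoc, Nat.factorial_succ]
  push_cast
  field_simp
  simp

lemma iterate_V_borelSum {c : ℕ → ℝ} (hc : ∀ j, |c j| ≤ 1) (q k : ℕ) :
    V^[k] (borelSum c q) = borelSum c (q + k) := by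
  induction k with
  | zero => rfl
  | succ k ih => rw [Function.iterate_succ_apply', ih, V_borelSum hc, add_assoc]

lemma besselJ_eq_borelSum (n : ℕ) : besselJ n = borelSum (besselCoeff n) n := by
  ext x
  have hinj : Function.Injective fun m : ℕ => 2 * m := fun a b h => by simpa using h
  unfold besselJ borelSum
  refine Eq.trans ?_ (hinj.tsum_eq ?_)
  · refine tsum_congr fun m => ?_
    have h2 : 2 * m / 2 = m := by omega
    simp only [besselCoeff, even_two_mul, if_true, h2]
    rw [Nat.cast_choose ℝ (show m ≤ 2 * m + n by omega), show 2 * m + n - m = m + n by omega]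
    rw [div_pow, div_pow, pow_add 2, pow_mul 2]
    norm_num
    field_simp
  · intro j hj
    by_contra hne
    apply hj
    have : ¬ Even j := fun ⟨m, hm⟩ => hne ⟨m, by simp; omega⟩
    simp [besselCoeff, this]

/-- Summing iterated integrals amounts to multiplying generating functions. -/
lemma tsum_mul_borelSum {a c : ℕ → ℝ} {C R : ℝ} (hC : 0 ≤ C) (hR : 0 ≤ R)
    (ha : ∀ k, |a k| ≤ C * R ^ k) (hc : ∀ j, |c j| ≤ 1) (q : ℕ) (x : ℝ) :
    ∑' k, a k * borelSum c (q + k) x =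
      borelSum (fun N => ∑ p ∈ Finset.HasAntidiagonal.antidiagonal N, a p.1 * c p.2) q x := by
  let F : ℕ × ℕ → ℝ := fun p =>
    a p.1 * (c p.2 * (x ^ (p.2 + (q + p.1)) / (Nat.factorial (p.2 + (q + p.1)))))
  have hF : Summable F := by
    have hs := (((Real.summable_pow_div_factorial (R * |x|)).mul_left C).mul_of_nonneg
      ((Real.summable_pow_div_factorial |x|).mul_right (|x| ^ q))
      (fun _ => by simp only [Pi.zero_apply]; positivity)
      (fun _ => by simp only [Pi.zero_apply]; positivity))
    refine Summable.of_norm_bounded hs ?_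
    rintro ⟨k, j⟩
    have hfac : (Nat.factorial k * Nat.factorial j : ℝ) ≤ Nat.factorial (j + (q + k)) := by
      calc (Nat.factorial k * Nat.factorial j : ℝ) ≤ Nat.factorial (k + j) := by
            exact_mod_cast Nat.le_of_dvd (Nat.factorial_pos _)
              (Nat.factorial_mul_factorial_dvd_factorial_add k j)
        _ ≤ _ := by exact_mod_cast Nat.factorial_le (by omega)
    simp only [F, Real.norm_eq_abs, abs_mul, abs_div, abs_pow, Nat.abs_cast]
    calc |a k| * (|c j| * (|x| ^ (j + (q + k)) / (Nat.factorial (j + (q + k)))))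
        ≤ (C * R ^ k) * (1 * (|x| ^ (j + (q + k)) / (Nat.factorial k * Nat.factorial j))) := by
          gcongr
          · exact ha k
          · exact hc j
      _ = _ := by
          rw [mul_pow, pow_add, pow_add]
          field_simp
  calc ∑' k, a k * borelSum c (q + k) x = ∑' k, ∑' j, F (k, j) := by
        simp only [borelSum, F, tsum_mul_left]
    _ = ∑' p, F p := (hF.tsum_prod' hF.prod_factor).symm
    _ = ∑' s, F (Finset.HasAntidiagonal.sigmaAntidiagonalEquivProd s) :=
        (Finset.HasAntidiagonal.sigmaAntidiagonalEquivProd.tsum_eq F).symm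
    _ = ∑' N, ∑' p : (Finset.HasAntidiagonal.antidiagonal N : Finset (ℕ × ℕ)), F p.1 :=
        (Finset.HasAntidiagonal.sigmaAntidiagonalEquivProd.summable_iff.2 hF).tsum_sigma'
          fun N => (hasSum_fintype _).summable
    _ = _ := by
        refine tsum_congr fun N => ?_
        rw [tsum_fintype, Finset.sum_coe_sort _ F, Finset.sum_mul]
        refine Finset.sum_congr rfl fun p hp => ?_
        rw [Finset.HasAntidiagonal.mem_antidiagonal] at hp
        simp only [F, ← hp]
        rw [show p.2 + (q + p.1) = p.1 + p.2 + q by ring]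
        ring

lemma analyticAt_sqrt_one_add_sq : AnalyticAt ℝ (fun t : ℝ => Real.sqrt (1 + t ^ 2)) 0 := by
  have h : (fun t : ℝ => Real.sqrt (1 + t ^ 2)) = fun t => Real.exp (Real.log (1 + t ^ 2) / 2) := by
    ext t
    rw [Real.exp_half, Real.exp_log (by positivity)]
  rw [h]
  have : AnalyticAt ℝ (fun t : ℝ => Real.log (1 + t ^ 2)) 0 :=
    AnalyticAt.log (by fun_prop) (by norm_num)
  fun_prop

lemma taylorSeries_sqrt_sq :
    taylorSeries (fun t : ℝ => Real.sqrt (1 + t ^ 2)) ^ 2 = 1 + PowerSeries.X ^ 2 := by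
  rw [← taylorSeries_pow analyticAt_sqrt_one_add_sq]
  have h : (fun t : ℝ => Real.sqrt (1 + t ^ 2)) ^ 2 = 1 + id ^ 2 := by
    ext t
    simp [Real.sq_sqrt (by positivity : (0 : ℝ) ≤ 1 + t ^ 2)]
  rw [h, taylorSeries_add (f := 1) analyticAt_const (analyticAt_id.pow 2), taylorSeries_one,
    taylorSeries_pow analyticAt_id, taylorSeries_id]

/-- `J_n` solves the differential equation `j_n(D) w = 0` associated with the rational
function `y(x+y)^n` on the hyperbola `y² − x² = 1`: with `h(t) = √(1+t²)(1+√(1+t²))^n`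
and `a_k` its Taylor coefficients at `0`, one has `Σ_k a_k (V^k J_n)(x) = x^n / n!`. -/
theorem besselJ_solves_hyperbola_ODE (n : ℕ)
    (h : ℝ → ℝ) (hdef : h = fun t => Real.sqrt (1 + t ^ 2) * (1 + Real.sqrt (1 + t ^ 2)) ^ n)
    (a : ℕ → ℝ) (hadef : a = fun k => iteratedDeriv k h 0 / (Nat.factorial k)) :
    ∀ x : ℝ, ∑' k, a k * (V^[k] (besselJ n)) x = x ^ n / (Nat.factorial n) := by
  intro x
  set s : ℝ → ℝ := fun t => Real.sqrt (1 + t ^ 2)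
  have hs : AnalyticAt ℝ s 0 := analyticAt_sqrt_one_add_sq
  have hs1 : AnalyticAt ℝ (1 + s) 0 := analyticAt_const.add hs
  have hh : h = s * (1 + s) ^ n := hdef
  have hT : taylorSeries h = taylorSeries s * (1 + taylorSeries s) ^ n := by
    rw [hh, taylorSeries_mul hs (hs1.pow n), taylorSeries_pow hs1,
      taylorSeries_add (f := 1) analyticAt_const hs, taylorSeries_one]
  have hinv : taylorSeries h * besselSeries n = 1 := by
    rw [hT]
    exact mul_besselSeries taylorSeries_sqrt_sq (by simp [taylorSeries]) n
  have hcoeff (k : ℕ) : (taylorSeries h).coeff k = a k := by simp [taylorSeries, hadef]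
  obtain ⟨C, R, hC, hR, hbound⟩ := exists_taylorSeries_coeff_le (hh ▸ hs.mul (hs1.pow n))
  simp only [hcoeff] at hbound
  have hconv (N : ℕ) : ∑ p ∈ Finset.HasAntidiagonal.antidiagonal N, a p.1 * besselCoeff n p.2 =
      if N = 0 then 1 else 0 := by
    rw [← PowerSeries.coeff_one, ← hinv, PowerSeries.coeff_mul]
    simp [hcoeff, besselSeries]
  simp only [besselJ_eq_borelSum, iterate_V_borelSum (abs_besselCoeff_le_one n)]
  rw [tsum_mul_borelSum hC hR hbound (abs_besselCoeff_le_one n)]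
  simp only [hconv, borelSum]
  rw [tsum_eq_single 0 (by intro N hN; simp [hN])]
  simp
end
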